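/- arXiv:1511.01874 — 6 statements merged into one kernel-verified Lean document; each statement's English description precedes it below -/
import Mathlib

section
/- Let G be a hypergraph and let T1 and T2 be sets of facts with T1 ⊆ T2. Let G' = G[reach(G, T2)] be the subhypergraph induced by the set of facts reachable from T2. Then reach(G, T1) = reach(G', T1). -/
/-- An arc is a pair of a head fact and a (finite) set of body facts. -/
abbrev Arc (α : Type*) := α × Finset α

/-- `reach G T` is the least set `R` of facts with `T ⊆ R` that is closed under
the arcs of `G`: for every arc `(h, B) ∈ G` with `B ⊆ R` we have `h ∈ R`. -/
def reach {α : Type*} (G : Set (Arc α)) (T : Set α) : Set α :=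
  ⋂₀ {R : Set α | T ⊆ R ∧ ∀ e ∈ G, (e.2 : Set α) ⊆ R → e.1 ∈ R}

/-- The induced subhypergraph `G[T]`. -/
def induced {α : Type*} (G : Set (Arc α)) (T : Set α) : Set (Arc α) :=
  {e ∈ G | e.1 ∈ T ∧ (e.2 : Set α) ⊆ T}

theorem subset_reach {α : Type*} (G : Set (Arc α)) (T : Set α) : T ⊆ reach G T :=
  Set.subset_sInter fun _ hR => hR.1

theorem reach_closed {α : Type*} {G : Set (Arc α)} {T : Set α} {e : Arc α} (he : e ∈ G)
    (hB : (e.2 : Set α) ⊆ reach G T) : e.1 ∈ reach G T :=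
  fun _ hR => hR.2 e he (hB.trans (Set.sInter_subset_of_mem hR))

theorem reach_subset {α : Type*} {G : Set (Arc α)} {T R : Set α} (hT : T ⊆ R)
    (hR : ∀ e ∈ G, (e.2 : Set α) ⊆ R → e.1 ∈ R) : reach G T ⊆ R :=
  Set.sInter_subset_of_mem ⟨hT, hR⟩

/-- Slicing: if `T₁ ⊆ T₂`, then reachability from `T₁` is unchanged if we restrict `G`
to the subhypergraph induced by the facts reachable from `T₂`. -/
theorem reach_induced_slice {α : Type*} (G : Set (Arc α)) (T₁ T₂ : Set α)
    (h : T₁ ⊆ T₂) : reach G T₁ = reach (induced G (reach G T₂)) T₁ := by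
  apply Set.Subset.antisymm
  · refine (reach_subset (R := reach (induced G (reach G T₂)) T₁ ∩ reach G T₂)
      (Set.subset_inter (subset_reach _ _) (h.trans (subset_reach _ _)))
      fun e he hB => ?_).trans Set.inter_subset_left
    have hB₂ := hB.trans Set.inter_subset_right
    have he₁ : e.1 ∈ reach G T₂ := reach_closed he hB₂
    exact ⟨reach_closed ⟨he, he₁, hB₂⟩ (hB.trans Set.inter_subset_left), he₁⟩
  · exact reach_subset (subset_reach _ _) fun _ he hB => reach_closed he.1 hB
end

section
/- Let q be a query for a well formed, monotone analysis A = (G,Q,P,p0,p1,π). If q ∈ reach(G^a, P_1(a)) for some abstraction a, then q ∈ A(a') for all abstractions a'. -/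
/-- An analysis `(G, Q, P, p₀, p₁, π)`: a global provenance hypergraph `G`, a set
`Q` of queries, parameters `P`, encoding functions `p₀, p₁ : P → α`, and a partial
projection function `π` on facts (modelled as `α → Option α`). -/
structure Analysis (α : Type*) (P : Type*) where
  G : Set (Arc α)
  Q : Set α
  p0 : P → α
  p1 : P → α
  proj : α → Option α

namespace Analysis

variable {α P : Type*} (A : Analysis α P)

/-- An abstraction (parameter setting) assigns a boolean to each parameter;
abstractions are ordered pointwise (`false ≤ true`). -/
abbrev Abstraction (P : Type*) := P → Bool

/-- `P₀(a) = { p₀(x) | a(x) = 0 }`. -/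
def P0 (a : Abstraction P) : Set α := A.p0 '' {x | a x = false}

/-- `P₁(a) = { p₁(x) | a(x) = 1 }`. -/
def P1 (a : Abstraction P) : Set α := A.p1 '' {x | a x = true}

/-- `A(a)`: the facts derived by the analysis under abstraction `a`. -/
def derived (a : Abstraction P) : Set α := reach A.G (A.P0 a ∪ A.P1 a)

/-- The cheapest abstraction `⊥`. -/
def bot : Abstraction P := fun _ => false

/-- The most precise abstraction `⊤`. -/
def top : Abstraction P := fun _ => true

/-- `G^a = G[A(a)]`. -/
def Gof (a : Abstraction P) : Set (Arc α) := induced A.G (A.derived a)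

/-- The projection lifted to sets of facts. -/
def projSet (T : Set α) : Set α := {y | ∃ t ∈ T, A.proj t = some y}

/-- The analysis is monotone: more precise abstractions derive fewer queries. -/
def MonotoneAnalysis : Prop :=
  ∀ a a' : Abstraction P, a ≤ a' → A.Q ∩ A.derived a' ⊆ A.Q ∩ A.derived a

/-- The analysis is well formed:
(i) facts derived under `⊥` are fixed points of `π`;
(ii) the image of `π` is contained in `A(⊥)`;
(iii) only fixed points project onto queries;
(iv) `p₀` and `p₁` are injective with disjoint images;
(v) `π ∘ p₁ = p₀`. -/
def WellFormed : Prop :=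
  (∀ x ∈ A.derived (bot : Abstraction P), A.proj x = some x) ∧
  (∀ x y : α, A.proj x = some y → y ∈ A.derived (bot : Abstraction P)) ∧
  (∀ q ∈ A.Q, ∀ x : α, A.proj x = some q → x = q) ∧
  Function.Injective A.p0 ∧ Function.Injective A.p1 ∧
  (∀ x y : P, A.p0 x ≠ A.p1 y) ∧
  (∀ x : P, A.proj (A.p1 x) = some (A.p0 x))

/-- A predictive provenance: a subhypergraph `H ⊆ G^⊥` such that projection and
reachability commute on the image of `P₁`, for every abstraction. -/
def Predictive (H : Set (Arc α)) : Prop :=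
  H ⊆ A.Gof (bot : Abstraction P) ∧
  ∀ a : Abstraction P,
    A.projSet (reach (A.Gof (top : Abstraction P)) (A.P1 a)) = reach H (A.projSet (A.P1 a))

end Analysis

theorem reach_mono {α : Type*} {G G' : Set (Arc α)} {T T' : Set α} (hG : G ⊆ G')
    (hT : T ⊆ T') : reach G T ⊆ reach G' T' := by
  rintro x hx R ⟨hTR, hR⟩
  exact hx R ⟨hT.trans hTR, fun e he => hR e (hG he)⟩

theorem Analysis.P1_mono {α P : Type*} (A : Analysis α P) : Monotone A.P1 :=
  fun _ _ hab => Set.image_mono fun x hx => Bool.eq_true_of_true_le (hx ▸ hab x)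

/-- If a query is reachable in `G^a` from `P₁(a)` alone for some abstraction `a`,
then it is derived by the analysis under every abstraction. -/
theorem query_impossible {α P : Type*} [Finite P] (A : Analysis α P)
    (hwf : A.WellFormed) (hmono : A.MonotoneAnalysis)
    (q : α) (hq : q ∈ A.Q)
    (a : Analysis.Abstraction P) (h : q ∈ reach (A.Gof a) (A.P1 a)) :
    ∀ a' : Analysis.Abstraction P, q ∈ A.derived a' := by
  have hq_top : q ∈ A.derived Analysis.top :=
    reach_mono (fun _ he => he.1)
      ((A.P1_mono fun _ => Bool.le_true _).trans Set.subset_union_right) h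
  exact fun a' => (hmono a' Analysis.top (fun _ => Bool.le_true _) ⟨hq, hq_top⟩).2
end

section
/- Let A = (G,Q,P,p0,p1,π) be a well formed, monotone analysis, let a be an abstraction, let H be a predictive provenance for A, and let q ∈ Q be a query with q ∈ A(⊥). If q ∉ A(a), then q ∉ reach(G^⊥, P_0(a)) and q ∉ reach(H, π(P_1(a))). -/
theorem induced_subset {α : Type*} (G : Set (Arc α)) (T : Set α) : induced G T ⊆ G :=
  Set.sep_subset _ _

/-- Predicting the first termination condition: if the query `q` (derived under `⊥`)
is not derived under `a`, then `q ∉ reach(G^⊥, P₀(a))` and `q ∉ reach(H, π(P₁(a)))`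
for any predictive provenance `H`. -/
theorem predict_termination_a {α P : Type*} [Finite P] (A : Analysis α P)
    (hwf : A.WellFormed) (hmono : A.MonotoneAnalysis)
    (H : Set (Arc α)) (hH : A.Predictive H)
    (q : α) (hq : q ∈ A.Q) (hqbot : q ∈ A.derived (Analysis.bot : Analysis.Abstraction P))
    (a : Analysis.Abstraction P) (hna : q ∉ A.derived a) :
    q ∉ reach (A.Gof (Analysis.bot : Analysis.Abstraction P)) (A.P0 a) ∧
      q ∉ reach H (A.projSet (A.P1 a)) := by
  refine ⟨fun h => hna (reach_mono (induced_subset _ _) Set.subset_union_left h), fun h => ?_⟩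
  rw [← hH.2 a] at h
  obtain ⟨t, ht, htq⟩ := h
  obtain rfl := hwf.2.2.1 q hq t htq
  exact hna (reach_mono (induced_subset _ _) Set.subset_union_right ht)
end

section
/- Let A = (G,Q,P,p0,p1,π) be a well formed, monotone analysis, let a be an abstraction, let H be a predictive provenance for A, and let q ∈ Q be a query with q ∈ A(⊥). Then q ∈ reach(G^a, P_1(a)) if and only if q ∈ reach(H, π(P_1(a))). -/
/-- Restricting a hypergraph to the facts reachable from `S` does not change what is
reachable from a subset of them. -/
theorem reach_induced_reach {α : Type*} {G : Set (Arc α)} {S T : Set α} (hT : T ⊆ reach G S) :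
    reach (induced G (reach G S)) T = reach G T := by
  apply Set.Subset.antisymm
  · exact reach_subset (subset_reach G T) fun e he hB => reach_closed he.1 hB
  · have h : reach G T ⊆ reach (induced G (reach G S)) T ∩ reach G S := by
      refine reach_subset (Set.subset_inter (subset_reach _ T) hT) fun e he hB => ?_
      have hS := hB.trans Set.inter_subset_right
      have hhead := reach_closed he hS
      exact ⟨reach_closed ⟨he, hhead, hS⟩ (hB.trans Set.inter_subset_left), hhead⟩
    exact h.trans Set.inter_subset_left

namespace Analysis

variable {α P : Type*} (A : Analysis α P)

theorem reach_Gof_P1 {a b : Abstraction P} (hab : a ≤ b) :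
    reach (A.Gof b) (A.P1 a) = reach A.G (A.P1 a) := by
  refine reach_induced_reach (subset_trans ?_ (subset_reach _ _))
  rintro _ ⟨x, hx, rfl⟩
  exact Or.inr ⟨x, Bool.eq_true_of_true_le (hx ▸ hab x), rfl⟩

theorem mem_projSet_iff_of_query (hwf : A.WellFormed) {q : α} (hq : q ∈ A.Q)
    (hqbot : q ∈ A.derived (bot : Abstraction P)) (T : Set α) : q ∈ A.projSet T ↔ q ∈ T := by
  constructor
  · rintro ⟨t, ht, hproj⟩
    exact hwf.2.2.1 q hq t hproj ▸ ht
  · exact fun h => ⟨q, h, hwf.1 q hqbot⟩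

end Analysis

/-- Predicting the second termination condition: for a query `q` derived under `⊥`
and a predictive provenance `H`,
`q ∈ reach(G^a, P₁(a))` if and only if `q ∈ reach(H, π(P₁(a)))`. -/
theorem predict_termination_b {α P : Type*} [Finite P] (A : Analysis α P)
    (hwf : A.WellFormed) (hmono : A.MonotoneAnalysis)
    (H : Set (Arc α)) (hH : A.Predictive H)
    (q : α) (hq : q ∈ A.Q) (hqbot : q ∈ A.derived (Analysis.bot : Analysis.Abstraction P))
    (a : Analysis.Abstraction P) :
    q ∈ reach (A.Gof a) (A.P1 a) ↔ q ∈ reach H (A.projSet (A.P1 a)) := by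
  rw [← hH.2 a, A.mem_projSet_iff_of_query hwf hq hqbot, A.reach_Gof_P1 le_rfl,
    A.reach_Gof_P1 (b := Analysis.top) fun x => Bool.le_true (a x)]
end

section
/- Let A = (G,Q,P,p0,p1,π) be an analysis and let a be an abstraction for A. Then reach(G^⊤, P_1(a)) = reach(G^a, P_1(a)). -/
/-- Provenance slicing: `reach(G^⊤, P₁(a)) = reach(G^a, P₁(a))`. -/
theorem provenance_slice {α P : Type*} [Finite P] (A : Analysis α P)
    (a : Analysis.Abstraction P) :
    reach (A.Gof (Analysis.top : Analysis.Abstraction P)) (A.P1 a)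
      = reach (A.Gof a) (A.P1 a) := by
  have h_top : A.P1 a ⊆ A.derived Analysis.top :=
    (Set.image_mono fun _ _ => rfl).trans (Set.subset_union_right.trans (subset_reach _ _))
  have h_a : A.P1 a ⊆ A.derived a := Set.subset_union_right.trans (subset_reach _ _)
  exact (reach_induced_reach h_top).trans (reach_induced_reach h_a).symm
end

section
/- Let m ≥ 1, and for each i ∈ {1,…,m} let p_i ∈ (0,1) and c_i > 0 be reals. For a permutation σ of {1,…,m}, define q_i(σ) = ∏_{j=1}^{i−1} (1 − p_{σ(j)}) and C(σ) = Σ_{i=1}^{m} q_i(σ) · c_{σ(i)}. Then a permutation σ minimises C over all permutations if and only if c_{σ(i)}/p_{σ(i)} ≤ c_{σ(j)}/p_{σ(j)} for all 1 ≤ i ≤ j ≤ m. -/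
/-- The expected total cost of trying the options of a list in order until the first success,
where option `i` costs `c i` and succeeds with probability `p i`. -/
def expectedCost {ι : Type*} (p c : ι → ℝ) : List ι → ℝ
  | [] => 0
  | a :: l => c a + (1 - p a) * expectedCost p c l

theorem sum_prod_Iio_eq_expectedCost {ι : Type*} (p c : ι → ℝ) (n : ℕ) (f : Fin n → ι) :
    ∑ i, (∏ j ∈ Finset.Iio i, (1 - p (f j))) * c (f i) = expectedCost p c (List.ofFn f) := by
  induction n with
  | zero => simp [expectedCost]
  | succ n ih =>
    have Iio_succ (i : Fin n) :
        Finset.Iio i.succ = Finset.cons 0 ((Finset.Iio i).map (Fin.succEmb n)) (by simp) := by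
      ext j
      cases j using Fin.cases <;> simp
    have Iio_zero : Finset.Iio (0 : Fin (n + 1)) = ∅ := by ext j; simp
    simp only [Fin.sum_univ_succ, List.ofFn_succ, expectedCost, Iio_succ, Iio_zero,
      Finset.prod_cons, Finset.prod_map, Finset.prod_empty, one_mul, Fin.coe_succEmb, mul_assoc,
      ← Finset.mul_sum, ← ih]

theorem expectedCost_cons_cons_le_swap_iff {ι : Type*} {p : ι → ℝ} (c : ι → ℝ)
    (hp : ∀ i, 0 < p i) (a b : ι) (l : List ι) :
    expectedCost p c (a :: b :: l) ≤ expectedCost p c (b :: a :: l) ↔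
      c a / p a ≤ c b / p b := by
  rw [div_le_div_iff₀ (hp a) (hp b)]
  simp only [expectedCost]
  constructor <;> intro h <;> nlinarith

theorem expectedCost_cons_le_cons_iff {ι : Type*} {p : ι → ℝ} (c : ι → ℝ)
    (hp : ∀ i, p i < 1) (a : ι) (l l' : List ι) :
    expectedCost p c (a :: l) ≤ expectedCost p c (a :: l') ↔
      expectedCost p c l ≤ expectedCost p c l' := by
  simp only [expectedCost, add_le_add_iff_left]
  exact mul_le_mul_iff_right₀ (sub_pos.2 (hp a))

theorem expectedCost_cons_append_le {ι : Type*} {p : ι → ℝ} (c : ι → ℝ)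
    (hp : ∀ i, 0 < p i ∧ p i < 1) (a : ι) (u v : List ι)
    (ha : ∀ b ∈ u, c a / p a ≤ c b / p b) :
    expectedCost p c (a :: (u ++ v)) ≤ expectedCost p c (u ++ a :: v) := by
  induction u with
  | nil => exact le_rfl
  | cons b u ih =>
    rw [List.forall_mem_cons] at ha
    exact ((expectedCost_cons_cons_le_swap_iff c (fun i => (hp i).1) a b _).2 ha.1).trans
      ((expectedCost_cons_le_cons_iff c (fun i => (hp i).2) b _ _).2 (ih ha.2))

theorem expectedCost_le_of_pairwise {ι : Type*} {p c : ι → ℝ}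
    (hp : ∀ i, 0 < p i ∧ p i < 1) {l l' : List ι}
    (hl : l.Pairwise fun a b => c a / p a ≤ c b / p b) (h : l'.Perm l) :
    expectedCost p c l ≤ expectedCost p c l' := by
  induction l generalizing l' with
  | nil => rw [h.eq_nil]
  | cons a l ih =>
    obtain ⟨u, v, rfl⟩ := List.append_of_mem (h.mem_iff.2 List.mem_cons_self)
    have huv : (u ++ v).Perm l := (List.perm_middle.symm.trans h).cons_inv
    rw [List.pairwise_cons] at hl
    exact ((expectedCost_cons_le_cons_iff c (fun i => (hp i).2) a _ _).2 (ih hl.2 huv)).trans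
      (expectedCost_cons_append_le c hp a u v fun b hb =>
        hl.1 b (huv.mem_iff.1 (List.mem_append_left v hb)))

theorem pairwise_of_expectedCost_le {ι : Type*} {p c : ι → ℝ}
    (hp : ∀ i, 0 < p i ∧ p i < 1) {l : List ι}
    (h : ∀ l' : List ι, l'.Perm l → expectedCost p c l ≤ expectedCost p c l') :
    l.Pairwise fun a b => c a / p a ≤ c b / p b := by
  induction l with
  | nil => exact List.Pairwise.nil
  | cons a l ih =>
    have hl := ih fun l' hl' =>
      (expectedCost_cons_le_cons_iff c (fun i => (hp i).2) a _ _).1 (h _ (hl'.cons a))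
    refine List.pairwise_cons.2 ⟨?_, hl⟩
    cases l with
    | nil => simp
    | cons b l =>
      have hab := (expectedCost_cons_cons_le_swap_iff c (fun i => (hp i).1) a b l).1
        (h _ (List.Perm.swap a b l))
      exact List.forall_mem_cons.2
        ⟨hab, fun d hd => hab.trans ((List.pairwise_cons.1 hl).1 d hd)⟩

theorem exists_perm_ofFn_eq {m : ℕ} (σ : Equiv.Perm (Fin m)) {l : List (Fin m)}
    (h : l.Perm (List.ofFn σ)) : ∃ τ : Equiv.Perm (Fin m), List.ofFn τ = l := by
  have hlen : m = l.length := by simpa using h.length_eq.symm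
  have hnodup : l.Nodup := h.nodup_iff.2 (List.nodup_ofFn.2 σ.injective)
  have hinj : Function.Injective fun i : Fin m => l.get (i.cast hlen) :=
    (List.nodup_iff_injective_get.1 hnodup).comp (Fin.cast_injective hlen)
  refine ⟨Equiv.ofBijective _ (Finite.injective_iff_bijective.1 hinj), ?_⟩
  apply List.ext_get <;> simp [← hlen]

theorem ofFn_perm_ofFn {m : ℕ} (σ τ : Equiv.Perm (Fin m)) :
    (List.ofFn τ).Perm (List.ofFn σ) := by
  rw [List.perm_ext_iff_of_nodup (List.nodup_ofFn.2 τ.injective) (List.nodup_ofFn.2 σ.injective)]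
  simp [List.mem_ofFn, τ.surjective _, σ.surjective _]

/-- Greedy ordering (Lemma `greedy`): with success probabilities `p i ∈ (0,1)` and
costs `c i > 0`, let `q_i(σ) = ∏_{j<i} (1 - p (σ j))` be the probability that the
first `i` options tried in order `σ` all fail, and let
`C(σ) = ∑ i, q_i(σ) · c (σ i)` be the expected total cost. A permutation `σ`
minimises `C` over all permutations iff the ratios `c (σ i) / p (σ i)` are
nondecreasing in `i`. -/
theorem greedy_order_optimal (m : ℕ) (hm : 1 ≤ m) (p c : Fin m → ℝ)
    (hp : ∀ i, 0 < p i ∧ p i < 1) (hc : ∀ i, 0 < c i)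
    (σ : Equiv.Perm (Fin m)) :
    (∀ τ : Equiv.Perm (Fin m),
        (∑ i : Fin m, (∏ j ∈ Finset.Iio i, (1 - p (σ j))) * c (σ i))
          ≤ ∑ i : Fin m, (∏ j ∈ Finset.Iio i, (1 - p (τ j))) * c (τ i))
      ↔ ∀ i j : Fin m, i ≤ j → c (σ i) / p (σ i) ≤ c (σ j) / p (σ j) := by
  simp only [sum_prod_Iio_eq_expectedCost]
  trans (List.ofFn σ).Pairwise fun a b => c a / p a ≤ c b / p b
  · refine ⟨fun h => pairwise_of_expectedCost_le hp fun l hl => ?_,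
      fun h τ => expectedCost_le_of_pairwise hp h (ofFn_perm_ofFn σ τ)⟩
    obtain ⟨τ, rfl⟩ := exists_perm_ofFn_eq σ hl
    exact h τ
  · rw [List.pairwise_ofFn]
    refine ⟨fun h i j hij => ?_, fun h i j hij => h i j hij.le⟩
    rcases hij.eq_or_lt with rfl | hij
    · exact le_rfl
    · exact h hij
end
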